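/- (Haagerup inequality for products of free groups.) Let r ∈ ℕ, n = (n_1,…,n_r) ∈ ℕ_0^r, and let f ∈ ℓ²(F_∞^r) be supported in E_n. Then for every g ∈ ℓ²(F_∞^r), the convolution f*g lies in ℓ²(F_∞^r) and ‖f*g‖_{ℓ²(F_∞^r)} ≤ (n_1+1)(n_2+1)⋯(n_r+1) · ‖f‖_{ℓ²(F_∞^r)} · ‖g‖_{ℓ²(F_∞^r)}. Equivalently, the convolution operator L_f : g ↦ f*g is bounded on ℓ²(F_∞^r) with operator norm ‖L_f‖ ≤ (n_1+1)⋯(n_r+1)‖f‖_{ℓ²(F_∞^r)}. -/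

import Mathlib

open scoped ENNReal

noncomputable section

/-- The free group on countably many generators `g_0, g_1, g_2, …`. -/
abbrev FG : Type := FreeGroup ℕ

/-- The reduced word length of an element of the free group. -/
def wordLength (x : FG) : ℕ := (FreeGroup.toWord x).length

/-- `ℓ²(F_∞^r)`. -/
abbrev l2 (r : ℕ) : Type := lp (fun _ : Fin r → FG => ℂ) 2

/-- Convolution of two elements of `ℓ²(F_∞^r)`:
`(f*g)(s) = Σ_{t u = s} f(t) g(u)`. -/
def conv {r : ℕ} (f g : l2 r) (s : Fin r → FG) : ℂ :=
  ∑' t : Fin r → FG, f t * g (t⁻¹ * s)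

/-- Cauchy–Schwarz for sums of extended nonnegative reals. -/
theorem ENNReal.sq_tsum_mul_le {ι : Type*} (F H : ι → ℝ≥0∞) :
    (∑' i, F i * H i) ^ 2 ≤ (∑' i, F i ^ 2) * ∑' i, H i ^ 2 := by
  let _ : MeasurableSpace ι := ⊤
  have h := ENNReal.lintegral_mul_le_Lp_mul_Lq MeasureTheory.Measure.count
    Real.HolderConjugate.two_two (measurable_from_top (f := F)).aemeasurable
    (measurable_from_top (f := H)).aemeasurable
  simp only [MeasureTheory.lintegral_count, Pi.mul_apply, ENNReal.rpow_two] at h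
  calc (∑' i, F i * H i) ^ 2
      ≤ ((∑' i, F i ^ 2) ^ (1 / 2 : ℝ) * (∑' i, H i ^ 2) ^ (1 / 2 : ℝ)) ^ 2 := by gcongr
    _ = (∑' i, F i ^ 2) * ∑' i, H i ^ 2 := by
      rw [mul_pow, ← ENNReal.rpow_two, ← ENNReal.rpow_two, ← ENNReal.rpow_mul, ← ENNReal.rpow_mul]
      norm_num

theorem ENNReal.sq_sum_le_card_mul {κ : Type*} (M : Finset κ) (F : κ → ℝ≥0∞) :
    (∑ k ∈ M, F k) ^ 2 ≤ M.card * ∑ k ∈ M, F k ^ 2 := by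
  have h := ENNReal.sq_tsum_mul_le (fun _ : M => 1) (fun k : M => F k)
  simpa [tsum_fintype, Finset.sum_attach M F, Finset.sum_attach M (fun k => F k ^ 2)] using h

open Classical in
/-- If `s` is determined by `(a s, c s)`, then the part of the convolution of `F` and `H` given by
the factorisations `s = t * u` with `a t = a s` and `d u = c s` satisfies the `ℓ²` bound with
constant one. -/
theorem tsum_sq_restricted_convolution_le {G A B : Type*} [Group G] (F H : G → ℝ≥0∞)
    (a : G → A) (c d : G → B) (hinj : Function.Injective fun s => (a s, c s)) :
    ∑' s, (∑' t, if a t = a s ∧ d (t⁻¹ * s) = c s then F t * H (t⁻¹ * s) else 0) ^ 2 ≤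
      (∑' t, F t ^ 2) * ∑' u, H u ^ 2 := by
  set P : A → ℝ≥0∞ := fun x => ∑' t : a ⁻¹' {x}, F t ^ 2
  set Q : B → ℝ≥0∞ := fun y => ∑' u : d ⁻¹' {y}, H u ^ 2
  have hs (s : G) :
      (∑' t, if a t = a s ∧ d (t⁻¹ * s) = c s then F t * H (t⁻¹ * s) else 0) ^ 2 ≤
        P (a s) * Q (c s) := by
    calc (∑' t, if a t = a s ∧ d (t⁻¹ * s) = c s then F t * H (t⁻¹ * s) else 0) ^ 2
        = (∑' t, (a ⁻¹' {a s}).indicator F t *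
            (d ⁻¹' {c s}).indicator H (t⁻¹ * s)) ^ 2 := by
          congr 2 with t
          by_cases h₁ : a t = a s <;> by_cases h₂ : d (t⁻¹ * s) = c s <;> simp [h₁, h₂]
      _ ≤ (∑' t, (a ⁻¹' {a s}).indicator F t ^ 2) *
            ∑' t, (d ⁻¹' {c s}).indicator H (t⁻¹ * s) ^ 2 := ENNReal.sq_tsum_mul_le _ _
      _ ≤ (∑' t, (a ⁻¹' {a s}).indicator F t ^ 2) *
            ∑' u, (d ⁻¹' {c s}).indicator H u ^ 2 := by
          refine mul_le_mul_right ?_ _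
          exact ENNReal.tsum_comp_le_tsum_of_injective (f := fun t : G => t⁻¹ * s)
            (fun x y h => by simpa using h) fun u => (d ⁻¹' {c s}).indicator H u ^ 2
      _ = P (a s) * Q (c s) := by
          simp only [P, Q, tsum_subtype _ (fun t => F t ^ 2), tsum_subtype _ (fun u => H u ^ 2)]
          congr 3 with t <;> simp only [Set.indicator] <;> split_ifs <;> simp
  calc _ ≤ ∑' s, P (a s) * Q (c s) := ENNReal.tsum_le_tsum hs
    _ ≤ ∑' p : A × B, P p.1 * Q p.2 :=
      ENNReal.tsum_comp_le_tsum_of_injective hinj fun p : A × B => P p.1 * Q p.2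
    _ = (∑' x, P x) * ∑' y, Q y := by
      rw [ENNReal.tsum_prod (f := fun x y => P x * Q y)]
      simp only [ENNReal.tsum_mul_left, ENNReal.tsum_mul_right]
    _ = (∑' t, F t ^ 2) * ∑' u, H u ^ 2 := by
      rw [ENNReal.tsum_fiberwise (fun t => F t ^ 2) a, ENNReal.tsum_fiberwise (fun u => H u ^ 2) d]

/-- An `ℓ²` convolution bound for groups in which every product `t * u` with `F t ≠ 0` is of one of
finitely many types `k ∈ M`, each governed by data as in `tsum_sq_restricted_convolution_le`. -/
theorem tsum_sq_convolution_le {G κ A B : Type*} [Group G] (M : Finset κ) (F H : G → ℝ≥0∞)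
    (a : κ → G → A) (c d : κ → G → B)
    (hinj : ∀ k, Function.Injective fun s => (a k s, c k s))
    (hcover : ∀ t s, F t ≠ 0 → ∃ k ∈ M, a k t = a k s ∧ d k (t⁻¹ * s) = c k s) :
    ∑' s, (∑' t, F t * H (t⁻¹ * s)) ^ 2 ≤
      (M.card : ℝ≥0∞) ^ 2 * ((∑' t, F t ^ 2) * ∑' u, H u ^ 2) := by
  classical
  set T : κ → G → G → ℝ≥0∞ := fun k s t =>
    if a k t = a k s ∧ d k (t⁻¹ * s) = c k s then F t * H (t⁻¹ * s) else 0
  have hT (s t : G) : F t * H (t⁻¹ * s) ≤ ∑ k ∈ M, T k s t := by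
    by_cases h0 : F t = 0
    · simp [h0]
    obtain ⟨k, hk, h⟩ := hcover t s h0
    calc F t * H (t⁻¹ * s) = T k s t := (if_pos h).symm
      _ ≤ _ := Finset.single_le_sum (f := fun k => T k s t) (fun _ _ => zero_le) hk
  calc ∑' s, (∑' t, F t * H (t⁻¹ * s)) ^ 2
      ≤ ∑' s, (M.card : ℝ≥0∞) * ∑ k ∈ M, (∑' t, T k s t) ^ 2 := by
        refine ENNReal.tsum_le_tsum fun s => ?_
        refine le_trans ?_ (ENNReal.sq_sum_le_card_mul M fun k => ∑' t, T k s t)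
        rw [← Summable.tsum_finsetSum fun _ _ => ENNReal.summable]
        gcongr with t
        exact hT s t
    _ = (M.card : ℝ≥0∞) * ∑ k ∈ M, ∑' s, (∑' t, T k s t) ^ 2 := by
        rw [ENNReal.tsum_mul_left, Summable.tsum_finsetSum fun _ _ => ENNReal.summable]
    _ ≤ (M.card : ℝ≥0∞) * ∑ _k ∈ M, (∑' t, F t ^ 2) * ∑' u, H u ^ 2 := by
        gcongr with k
        exact tsum_sq_restricted_convolution_le F H (a k) (c k) (d k) (hinj k)
    _ = _ := by rw [Finset.sum_const, nsmul_eq_mul, ← mul_assoc, sq]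

/-- After removing their longest common prefix, two reduced words have a reduced quotient. -/
theorem FreeGroup.IsReduced.exists_common_prefix {α : Type*} :
    ∀ {L₁ L₂ : List (α × Bool)}, FreeGroup.IsReduced L₁ → FreeGroup.IsReduced L₂ →
      ∃ p b c, L₁ = p ++ b ∧ L₂ = p ++ c ∧ FreeGroup.IsReduced (FreeGroup.invRev b ++ c)
  | [], L₂, _, h₂ => ⟨[], [], L₂, by simp, by simp, by simpa using h₂⟩
  | x :: l₁, [], h₁, _ => by
    classical
    refine ⟨[], x :: l₁, [], by simp, by simp, ?_⟩
    rw [List.append_nil, FreeGroup.isReduced_iff_reduce_eq, FreeGroup.reduce_invRev, h₁.reduce_eq]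
  | x :: l₁, y :: l₂, h₁, h₂ => by
    classical
    by_cases hxy : x = y
    · subst hxy
      obtain ⟨p, b, c, rfl, rfl, h⟩ := FreeGroup.IsReduced.exists_common_prefix
        (h₁.infix (List.suffix_cons x l₁).isInfix) (h₂.infix (List.suffix_cons x l₂).isInfix)
      exact ⟨x :: p, b, c, by simp, by simp, h⟩
    · refine ⟨[], x :: l₁, y :: l₂, by simp, by simp, ?_⟩
      have h₁' : FreeGroup.IsReduced (FreeGroup.invRev (x :: l₁)) := by
        rw [FreeGroup.isReduced_iff_reduce_eq, FreeGroup.reduce_invRev, h₁.reduce_eq]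
      rw [FreeGroup.invRev_cons] at h₁' ⊢
      refine h₁'.append_overlap ?_ (by simp [FreeGroup.invRev])
      obtain ⟨x, e⟩ := x
      obtain ⟨y, e'⟩ := y
      simp only [FreeGroup.invRev, List.map_cons, List.map_nil, List.reverse_singleton,
        List.singleton_append, FreeGroup.isReduced_cons_cons]
      refine ⟨fun h => ?_, h₂⟩
      cases e <;> cases e' <;> simp_all

theorem FreeGroup.exists_take_eq_take {α : Type*} [DecidableEq α] (x y : FreeGroup α) :
    ∃ m ≤ x.toWord.length, x.toWord.take m = y.toWord.take m ∧
      (x⁻¹ * y).toWord.drop (x.toWord.length - m) = y.toWord.drop m := by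
  obtain ⟨p, b, c, hx, hy, h⟩ := FreeGroup.IsReduced.exists_common_prefix
    (FreeGroup.isReduced_toWord (x := x)) (FreeGroup.isReduced_toWord (x := y))
  have hxy : (x⁻¹ * y).toWord = FreeGroup.invRev b ++ c := by
    rw [← h.reduce_eq, ← FreeGroup.toWord_mk]
    congr 1
    rw [← FreeGroup.mk_toWord (x := x), ← FreeGroup.mk_toWord (x := y), hx, hy,
      ← FreeGroup.mul_mk, ← FreeGroup.mul_mk, ← FreeGroup.mul_mk, ← FreeGroup.inv_mk]
    group
  refine ⟨p.length, by simp [hx], by simp [hx, hy], ?_⟩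
  rw [hxy, hx, hy, List.length_append, Nat.add_sub_cancel_left, ← FreeGroup.invRev_length (L₁ := b),
    List.drop_left, List.drop_left]

theorem tsum_enorm_sq_eq {r : ℕ} (f : l2 r) : ∑' t, ‖f t‖ₑ ^ 2 = ENNReal.ofReal (‖f‖ ^ 2) := by
  have h : HasSum (fun t => ‖f t‖ ^ 2) (‖f‖ ^ 2) := by
    simpa using lp.hasSum_norm (p := 2) (by norm_num) f
  rw [← h.tsum_eq, ENNReal.ofReal_tsum_of_nonneg (fun _ => by positivity) h.summable]
  simp [ENNReal.ofReal_pow]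

theorem tsum_enorm_conv_sq_le {r : ℕ} {n : Fin r → ℕ} {f : l2 r}
    (hf : ∀ t : Fin r → FG, f t ≠ 0 → ∀ j, wordLength (t j) = n j) (g : l2 r) :
    ∑' s, ‖conv f g s‖ₑ ^ 2 ≤
      ENNReal.ofReal (((∏ j, ((n j : ℝ) + 1)) * ‖f‖ * ‖g‖) ^ 2) := by
  set M : Finset (Fin r → ℕ) := Fintype.piFinset fun j => Finset.range (n j + 1)
  have hM : (M.card : ℝ≥0∞) = ENNReal.ofReal (∏ j, ((n j : ℝ) + 1)) := by
    rw [← ENNReal.ofReal_natCast]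
    simp [M]
  calc ∑' s, ‖conv f g s‖ₑ ^ 2 ≤ ∑' s, (∑' t, ‖f t‖ₑ * ‖g (t⁻¹ * s)‖ₑ) ^ 2 := by
        gcongr with s
        simpa only [conv, enorm_mul] using
          enorm_tsum_le_tsum_enorm (f := fun t => f t * g (t⁻¹ * s))
    _ ≤ (M.card : ℝ≥0∞) ^ 2 * ((∑' t, ‖f t‖ₑ ^ 2) * ∑' u, ‖g u‖ₑ ^ 2) := by
        refine tsum_sq_convolution_le M (fun t => ‖f t‖ₑ) (fun u => ‖g u‖ₑ)
          (fun m t j => (t j).toWord.take (m j)) (fun m s j => (s j).toWord.drop (m j))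
          (fun m u j => (u j).toWord.drop (n j - m j)) (fun m x y h => ?_) fun t s ht => ?_
        · simp only [Prod.mk.injEq, funext_iff] at h
          funext j
          apply FreeGroup.toWord_injective
          rw [← List.take_append_drop (m j) (x j).toWord, h.1 j, h.2 j, List.take_append_drop]
        · choose m hm htake hdrop using fun j => FreeGroup.exists_take_eq_take (t j) (s j)
          have hn (j) : (t j).toWord.length = n j := hf t (by simpa using ht) j
          simp only [hn] at hm hdrop
          exact ⟨m, by simpa [M, Nat.lt_succ_iff] using hm, funext htake, funext hdrop⟩
    _ = _ := by
        rw [hM, tsum_enorm_sq_eq, tsum_enorm_sq_eq, mul_pow, mul_pow, mul_assoc,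
          ENNReal.ofReal_mul (by positivity), ENNReal.ofReal_mul (by positivity),
          ENNReal.ofReal_pow (p := ∏ j, ((n j : ℝ) + 1)) (by positivity)]

/-- Haagerup inequality for products of free groups: if `f ∈ ℓ²(F_∞^r)` is supported
in `E_n`, then for every `g ∈ ℓ²(F_∞^r)` the convolution `f*g` lies in `ℓ²(F_∞^r)` and
`‖f*g‖₂ ≤ (n_1+1)⋯(n_r+1) ‖f‖₂ ‖g‖₂`; equivalently, the convolution operator
`L_f : g ↦ f*g` is bounded with `‖L_f‖ ≤ (n_1+1)⋯(n_r+1) ‖f‖₂`. -/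
theorem haagerup_inequality_product_free_groups (r : ℕ) (n : Fin r → ℕ)
    (f : l2 r)
    (hf : ∀ t : Fin r → FG, f t ≠ 0 → ∀ j, wordLength (t j) = n j) :
    ∀ g : l2 r, ∃ h : l2 r,
      (∀ s : Fin r → FG, h s = conv f g s) ∧
      ‖h‖ ≤ (∏ j, ((n j : ℝ) + 1)) * ‖f‖ * ‖g‖ := by
  intro g
  set C : ℝ := (∏ j, ((n j : ℝ) + 1)) * ‖f‖ * ‖g‖
  have hC0 : 0 ≤ C := by positivity
  have hle (S : Finset (Fin r → FG)) : ∑ s ∈ S, ‖conv f g s‖ ^ 2 ≤ C ^ 2 := by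
    rw [← ENNReal.ofReal_le_ofReal_iff (by positivity),
      ENNReal.ofReal_sum_of_nonneg fun _ _ => by positivity]
    simp only [ENNReal.ofReal_pow (norm_nonneg _), ofReal_norm]
    exact (ENNReal.sum_le_tsum S).trans (tsum_enorm_conv_sq_le hf g)
  have hmem : Memℓp (conv f g) 2 := memℓp_gen' (C := C ^ 2) fun S => by simpa using hle S
  exact ⟨⟨conv f g, hmem⟩, fun _ => rfl,
    lp.norm_le_of_forall_sum_le (by norm_num) hC0 fun S => by simpa using hle S⟩
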